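/- (Vaserstein) Let B be a commutative ring and let [b₁, …, b_n] ∈ Um_n(B) be a unimodular row, n ≥ 3. Let d be a positive integer. Then [b₁^d, b₂, …, b_n] and [b₁, b₂^d, …, b_n] lie in the same orbit under the action of the elementary group E_n(B). -/

import Mathlib

/-- `Um_n(B)`: unimodular rows of length `n` over `B`. -/
def IsUmRow {B : Type*} [CommRing B] {n : ℕ} (v : Fin n → B) : Prop :=
  Ideal.span (Set.range v) = ⊤

/-- `E_n(B)`: the subgroup (here: submonoid, the generating set being closed under inverses) of
`SL_n(B)` generated by the elementary matrices `E_ij(c)`, `i ≠ j`. -/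
def elementarySubmonoid (n : ℕ) (B : Type*) [CommRing B] :
    Submonoid (Matrix (Fin n) (Fin n) B) :=
  Submonoid.closure {E | ∃ (i j : Fin n) (c : B), i ≠ j ∧ E = Matrix.transvection i j c}

/-- Two rows are in the same orbit under the action of `E_n(B)` (by right multiplication). -/
def AbsERel {B : Type*} [CommRing B] {n : ℕ} (v w : Fin n → B) : Prop :=
  ∃ E ∈ elementarySubmonoid n B, w = Matrix.vecMul v E

theorem AbsERel.refl' {B : Type*} [CommRing B] {n : ℕ} (v : Fin n → B) : AbsERel v v :=
  ⟨1, Submonoid.one_mem _, by simp⟩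

theorem AbsERel.trans' {B : Type*} [CommRing B] {n : ℕ} {u v w : Fin n → B}
    (h : AbsERel u v) (h' : AbsERel v w) : AbsERel u w := by
  obtain ⟨E, hE, rfl⟩ := h
  obtain ⟨F, hF, rfl⟩ := h'
  exact ⟨E * F, Submonoid.mul_mem _ hE hF, by rw [Matrix.vecMul_vecMul]⟩

theorem AbsERel.step {B : Type*} [CommRing B] {n : ℕ} (v : Fin n → B) (i j : Fin n)
    (hij : i ≠ j) (c : B) : AbsERel v (Function.update v j (v j + v i * c)) := by
  refine ⟨Matrix.transvection i j c, Submonoid.subset_closure ⟨i, j, c, hij, rfl⟩, ?_⟩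
  funext k
  rw [Matrix.transvection, Matrix.vecMul_add, Matrix.vecMul_one, Pi.add_apply]
  simp only [Matrix.vecMul, dotProduct, Matrix.single_apply]
  by_cases hk : k = j
  · subst hk; simp
  · simp [hk, Ne.symm hk]

theorem AbsERel.add_mem {B : Type*} [CommRing B] {n : ℕ} (v : Fin n → B) (i : Fin n) (x : B)
    (hx : x ∈ Ideal.span (v '' {j | j ≠ i})) :
    ∀ r y : B, AbsERel (Function.update v i y) (Function.update v i (y + r * x)) := by
  refine Submodule.span_induction (p := fun x _ => ∀ r y : B,
    AbsERel (Function.update v i y) (Function.update v i (y + r * x))) ?_ ?_ ?_ ?_ hx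
  · rintro _ ⟨j, hj, rfl⟩ r y
    have := AbsERel.step (Function.update v i y) j i hj r
    simpa [Function.update_of_ne hj, mul_comm] using this
  · intro r y; simpa using AbsERel.refl' _
  · intro a b _ _ ha hb r y
    have := (ha r y).trans' (hb r (y + r * a))
    rwa [add_assoc, ← mul_add] at this
  · intro a b _ hb r y
    have := hb (r * a) y
    rwa [mul_assoc] at this

/-- Abstract two-coordinate computation modulo `J`. -/
theorem abstract_swap {B : Type*} [CommRing B] (R : B → B → B → B → Prop) (J : Ideal B)
    (tr : ∀ {a b c d e f}, R a b c d → R c d e f → R a b e f)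
    (h1 : ∀ x y t j x', j ∈ J → x' = x + t * y + j → R x y x' y)
    (h2 : ∀ x y t j y', j ∈ J → y' = y + t * x + j → R x y x y')
    (b c y z s u' : B) (hyz : 1 - b * y - c * z ∈ J)
    (hu : (1 + s * b * y ^ 2) * u' - 1 ∈ J) : R (b + s) c b c ∧ R b c (b + s) c := by
  set u := 1 + s * b * y ^ 2 with hudef
  have m1 : ∀ k, k * (1 - b * y - c * z) ∈ J := fun k => J.mul_mem_left k hyz
  have m2 : ∀ k, k * (u * u' - 1) ∈ J := fun k => J.mul_mem_left k hu
  -- b + s -> u b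
  have A : R (b + s) c (u * b) c := by
    refine h1 _ _ (-(s * z * (1 + b * y))) (-(s * (1 + b * y)) * (1 - b * y - c * z)) _ (m1 _) ?_
    rw [hudef]; ring
  have A' : R (u * b) c (b + s) c := by
    refine h1 _ _ (s * z * (1 + b * y)) ((s * (1 + b * y)) * (1 - b * y - c * z)) _ (m1 _) ?_
    rw [hudef]; ring
  have C : R b (u * c) b c := by
    refine h2 _ _ (-(s * y ^ 2 * c)) 0 _ J.zero_mem ?_
    rw [hudef]; ring
  have C' : R b c b (u * c) := by
    refine h2 _ _ (s * y ^ 2 * c) 0 _ J.zero_mem ?_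
    rw [hudef]; ring
  have W : ∀ (x y p q : B), p * q - 1 ∈ J → R x y (p * y) (-(q * x)) := by
    intro x y p q hpq
    refine tr (h1 x y p 0 (x + p * y) J.zero_mem (by ring)) ?_
    refine tr (h2 _ y (-q) (y * (p * q - 1)) (-(q * x)) (J.mul_mem_left _ hpq) (by ring)) ?_
    exact h1 _ _ p (x * (p * q - 1)) _ (J.mul_mem_left _ hpq) (by ring)
  have W1 : ∀ x y : B, R x y (-y) x := by
    intro x y
    have := W x y (-1) (-1) (by simp)
    simpa using this
  have Bf : R (u * b) c b (u * c) := by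
    refine tr (W (u * b) c u u' hu) ?_
    refine tr (W1 _ _) ?_
    exact h1 _ _ 0 (-b * (u * u' - 1)) _ (m2 _) (by ring)
  have Bb : R b (u * c) (u * b) c := by
    refine tr (W b (u * c) u' u (by simpa [mul_comm] using hu)) ?_
    refine tr (W1 _ _) ?_
    refine tr (h2 _ _ 0 (-c * (u * u' - 1)) c (m2 _) (by ring)) ?_
    exact h1 _ _ 0 0 _ J.zero_mem (by ring)
  exact ⟨tr A (tr Bf C), tr C' (tr Bb A')⟩

theorem key_step {B : Type*} [CommRing B] (m : ℕ) (v : Fin (m + 3) → B) (d : ℕ) (hd : 0 < d)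
    (a s : B) (hv : IsUmRow (Function.update v 0 a)) :
    AbsERel (Function.update v 0 (a ^ d))
      (Function.update (Function.update v 0 (a ^ d)) 1 (v 1 + s * a)) := by
  set w := Function.update v 0 (a ^ d) with hw
  have h12 : (1 : Fin (m + 3)) ≠ 2 := by
    simp only [ne_eq, Fin.ext_iff, Fin.val_one, Fin.val_two]; omega
  have h10 : (1 : Fin (m + 3)) ≠ 0 := by simp
  have h20 : (2 : Fin (m + 3)) ≠ 0 := by
    simp only [ne_eq, Fin.ext_iff, Fin.val_two, Fin.val_zero]; omega
  set J : Ideal B := Ideal.span (w '' {j | j ≠ 1 ∧ j ≠ 2}) with hJ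
  have haJ : a ^ d ∈ J := Ideal.subset_span ⟨0, ⟨h10.symm, h20.symm⟩, by simp [hw]⟩
  have hw1 : w 1 = v 1 := by simp [hw]
  -- unimodularity
  have htop : Ideal.span {v 1} ⊔ (Ideal.span {w 2} ⊔ J) = ⊤ := by
    rw [← Ideal.radical_eq_top, eq_top_iff, ← hv, Ideal.span_le]
    rintro _ ⟨j, rfl⟩
    by_cases h0 : j = 0
    · subst h0
      simp only [Function.update_self]
      exact ⟨d, (le_sup_right.trans le_sup_right : J ≤ _) haJ⟩
    · refine Ideal.le_radical ?_
      rw [Function.update_of_ne h0]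
      have hj : w j = v j := by simp [hw, h0]
      by_cases h1 : j = 1
      · subst h1
        exact (le_sup_left : Ideal.span {v 1} ≤ _) (Ideal.mem_span_singleton_self _)
      · by_cases h2 : j = 2
        · subst h2
          rw [← hj]
          exact (le_sup_left.trans le_sup_right : Ideal.span {w 2} ≤ _)
            (Ideal.mem_span_singleton_self _)
        · exact (le_sup_right.trans le_sup_right : J ≤ _)
            (Ideal.subset_span ⟨j, ⟨h1, h2⟩, hj⟩)
  have hone : (1 : B) ∈ Ideal.span {v 1} ⊔ (Ideal.span {w 2} ⊔ J) := by rw [htop]; trivial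
  obtain ⟨p, hp, q, hq, hpq⟩ := Submodule.mem_sup.1 hone
  obtain ⟨r, hr, j, hj, hrj⟩ := Submodule.mem_sup.1 hq
  obtain ⟨y, rfl⟩ := Ideal.mem_span_singleton.1 hp
  obtain ⟨z, rfl⟩ := Ideal.mem_span_singleton.1 hr
  have hyz : 1 - v 1 * y - w 2 * z ∈ J := by
    have : 1 - v 1 * y - w 2 * z = j := by rw [← hpq, ← hrj]; ring
    rwa [this]
  obtain ⟨u', hu'⟩ := one_sub_dvd_one_sub_pow (-(a * (s * v 1 * y ^ 2))) d
  have hu : (1 + (s * a) * v 1 * y ^ 2) * u' - 1 ∈ J := by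
    have : (1 + (s * a) * v 1 * y ^ 2) * u' - 1 = (-(-(s * v 1 * y ^ 2)) ^ d) * a ^ d := by
      have e : (1 + (s * a) * v 1 * y ^ 2) * u' = 1 - (-(a * (s * v 1 * y ^ 2))) ^ d := by
        rw [hu']; ring
      rw [e, show -(a * (s * v 1 * y ^ 2)) = -(s * v 1 * y ^ 2) * a by ring, mul_pow]; ring
    rw [this]; exact J.mul_mem_left _ haJ
  have main := (abstract_swap (fun x y x' y' =>
    AbsERel (Function.update (Function.update w 1 x) 2 y)
      (Function.update (Function.update w 1 x') 2 y')) J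
      (fun h h' => h.trans' h') ?_ ?_ (v 1) (w 2) y z (s * a) u' hyz hu).2
  · have e1 : Function.update (Function.update w 1 (v 1)) 2 (w 2) = w := by
      rw [← hw1]; simp
    have e2 : Function.update (Function.update w 1 (v 1 + s * a)) 2 (w 2)
        = Function.update w 1 (v 1 + s * a) := by
      rw [Function.update_eq_self_iff]; simp [h12.symm]
    simpa only [e1, e2] using main
  · intro x y t j x' hj hx'
    have := AbsERel.add_mem (Function.update w 2 y) 1 (t * y + j) ?_ 1 x
    · rw [Function.update_comm h12, Function.update_comm h12, hx']
      simpa [add_assoc] using this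
    · refine Ideal.add_mem _ (Ideal.mul_mem_left _ _ (Ideal.subset_span ⟨2, h12.symm, by simp⟩)) ?_
      refine Ideal.span_mono ?_ hj
      rintro _ ⟨k, ⟨hk1, hk2⟩, rfl⟩
      exact ⟨k, hk1, by simp [hk2]⟩
  · intro x y t j y' hj hy'
    have := AbsERel.add_mem (Function.update w 1 x) 2 (t * x + j) ?_ 1 y
    · rw [hy']
      simpa [add_assoc] using this
    · refine Ideal.add_mem _ (Ideal.mul_mem_left _ _ (Ideal.subset_span ⟨1, h12, by simp⟩)) ?_
      refine Ideal.span_mono ?_ hj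
      rintro _ ⟨k, ⟨hk1, hk2⟩, rfl⟩
      exact ⟨k, hk2, by simp [hk1]⟩

theorem vaserstein_power_swap (B : Type*) [CommRing B] (m : ℕ)
    (v : Fin (m + 3) → B) (hv : IsUmRow v) (d : ℕ) (hd : 0 < d) :
    AbsERel (Function.update v 0 (v 0 ^ d)) (Function.update v 1 (v 1 ^ d)) := by
  have h10 : (1 : Fin (m + 3)) ≠ 0 := by simp
  let Q : B → B → Fin (m + 3) → B := fun x y => Function.update (Function.update v 0 x) 1 y
  have g1 : ∀ x y t x', x' = x + t * y → AbsERel (Q x y) (Q x' y) := by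
    intro x y t x' h
    have := AbsERel.step (Q x y) 1 0 h10 t
    convert this using 1
    simp only [Q, h]
    rw [Function.update_comm h10, Function.update_idem]
    simp [h10.symm, mul_comm]
  have g2 : ∀ x y t y', y' = y + t * x → AbsERel (Q x y) (Q x y') := by
    intro x y t y' h
    have := AbsERel.step (Q x y) 0 1 h10.symm t
    convert this using 1
    simp only [Q, h]
    simp [h10.symm, mul_comm]
  have key : ∀ a b s : B, IsUmRow (Q a b) → AbsERel (Q (a ^ d) b) (Q (a ^ d) (b + s * a)) := by
    intro a b s h
    have := key_step m (Function.update v 1 b) d hd a s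
      (by simpa only [Q, Function.update_comm h10] using h)
    simpa only [Q, Function.update_comm h10.symm, Function.update_idem,
      Function.update_self] using this
  have hQ : Q (v 0) (v 1) = v := by simp [Q]
  have hum : IsUmRow (Q (v 1) (v 1 - v 0)) := by
    unfold IsUmRow at hv ⊢
    rw [eq_top_iff, ← hv, Ideal.span_le]
    rintro _ ⟨j, rfl⟩
    have m0 : v 1 ∈ Ideal.span (Set.range (Q (v 1) (v 1 - v 0))) :=
      Ideal.subset_span ⟨0, by simp [Q, h10.symm]⟩
    have m1 : v 1 - v 0 ∈ Ideal.span (Set.range (Q (v 1) (v 1 - v 0))) :=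
      Ideal.subset_span ⟨1, by simp [Q]⟩
    by_cases h0 : j = 0
    · subst h0
      have := Ideal.sub_mem _ m0 m1
      simpa using this
    by_cases h1 : j = 1
    · subst h1; exact m0
    · exact Ideal.subset_span ⟨j, by simp [Q, h0, h1]⟩
  have s1 := key (v 0) (v 1) (-1) (by rwa [hQ])
  have s2 : AbsERel (Q (v 0 ^ d) (v 1 + -1 * v 0)) (Q (v 1 ^ d) (v 1 - v 0)) := by
    obtain ⟨k, hk⟩ := sub_dvd_pow_sub_pow (v 1) (v 0) d
    rw [show v 1 + -1 * v 0 = v 1 - v 0 by ring]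
    refine g1 _ _ k _ ?_
    linear_combination hk
  have s3 := key (v 1) (v 1 - v 0) (-1) hum
  rw [show v 1 - v 0 + -1 * v 1 = -v 0 by ring] at s3
  have s4 : AbsERel (Q (v 1 ^ d) (-v 0)) (Q (v 0) (v 1 ^ d)) := by
    refine (g1 _ _ (-1) (v 1 ^ d + v 0) (by ring)).trans' ?_
    refine (g2 _ _ 1 (v 1 ^ d) (by ring)).trans' ?_
    exact g1 _ _ (-1) _ (by ring)
  have fin := ((s1.trans' s2).trans' s3).trans' s4
  have e1 : Q (v 0 ^ d) (v 1) = Function.update v 0 (v 0 ^ d) := by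
    simp only [Q]; rw [Function.update_eq_self_iff]; simp
  have e2 : Q (v 0) (v 1 ^ d) = Function.update v 1 (v 1 ^ d) := by simp [Q]
  rwa [e1, e2] at fin
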